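/- arXiv:2303.06694 — 7 statements merged into one kernel-verified Lean document; each statement's English description precedes it below -/
import Mathlib

section
/- For each fixed t > 0, the radial profile ρ_t : [0,∞) → [0,∞) of the diffusion metric, defined by ρ_t(r) = (∫_{ℝⁿ} |W_t(r e₁ − z) − W_t(z)|² dz)^{1/2} with e₁ the first standard basis vector, is continuous on [0,∞), satisfies ρ_t(0) = 0, and is strictly increasing on [0,∞). -/
open MeasureTheory Real

/-- The Weierstrass (heat) kernel on `ℝⁿ`: `W_t(x) = (4πt)^{-n/2} exp(-|x|²/(4t))`. -/
noncomputable def weierstrass (n : ℕ) (t : ℝ) (x : EuclideanSpace ℝ (Fin n)) : ℝ :=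
  (4 * Real.pi * t) ^ (-(n : ℝ) / 2) * Real.exp (-‖x‖ ^ 2 / (4 * t))

/-- The radial profile of the diffusion metric:
`ρ_t(r) = (∫ |W_t(r e₁ - z) - W_t(z)|² dz)^{1/2}`. -/
noncomputable def diffProfile (n : ℕ) [NeZero n] (t r : ℝ) : ℝ :=
  Real.sqrt (∫ z : EuclideanSpace ℝ (Fin n),
    |weierstrass n t (r • EuclideanSpace.single (0 : Fin n) 1 - z) - weierstrass n t z| ^ 2)

/-- The squared difference of two heat kernels is a combination of three translated Gaussians. -/
lemma weierstrass_sub_sq (n : ℕ) {t : ℝ} (ht : 0 < t) (v z : EuclideanSpace ℝ (Fin n)) :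
    |weierstrass n t (v - z) - weierstrass n t z| ^ 2 =
      ((4 * Real.pi * t) ^ (-(n : ℝ) / 2)) ^ 2 *
        (Real.exp (-(1 / (2 * t)) * ‖v - z‖ ^ 2) + Real.exp (-(1 / (2 * t)) * ‖z‖ ^ 2) -
          2 * Real.exp (-‖v‖ ^ 2 / (8 * t)) *
            Real.exp (-(1 / (2 * t)) * ‖z - (1 / 2 : ℝ) • v‖ ^ 2)) := by
  have h₁ : Real.exp (-(1 / (2 * t)) * ‖v - z‖ ^ 2) = Real.exp (-‖v - z‖ ^ 2 / (4 * t)) ^ 2 := by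
    rw [← Real.exp_nat_mul]
    congr 1
    push_cast
    field_simp
    ring
  have h₂ : Real.exp (-(1 / (2 * t)) * ‖z‖ ^ 2) = Real.exp (-‖z‖ ^ 2 / (4 * t)) ^ 2 := by
    rw [← Real.exp_nat_mul]
    congr 1
    push_cast
    field_simp
    ring
  have h₃ : Real.exp (-‖v‖ ^ 2 / (8 * t)) *
      Real.exp (-(1 / (2 * t)) * ‖z - (1 / 2 : ℝ) • v‖ ^ 2) =
      Real.exp (-‖v - z‖ ^ 2 / (4 * t)) * Real.exp (-‖z‖ ^ 2 / (4 * t)) := by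
    rw [← Real.exp_add, ← Real.exp_add, norm_sub_sq_real, norm_sub_sq_real, norm_smul,
      inner_smul_right, real_inner_comm z v, Real.norm_of_nonneg (by norm_num : (0 : ℝ) ≤ 1 / 2)]
    congr 1
    field_simp
    ring
  rw [sq_abs, mul_assoc 2, h₁, h₂, h₃, weierstrass, weierstrass]
  ring

/-- The integral of the squared difference of a heat kernel and its translate by `v`. -/
lemma integral_weierstrass_sub_sq (n : ℕ) {t : ℝ} (ht : 0 < t) (v : EuclideanSpace ℝ (Fin n)) :
    ∫ z, |weierstrass n t (v - z) - weierstrass n t z| ^ 2 =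
      2 * ((4 * Real.pi * t) ^ (-(n : ℝ) / 2)) ^ 2 *
        (∫ z : EuclideanSpace ℝ (Fin n), Real.exp (-(1 / (2 * t)) * ‖z‖ ^ 2)) *
          (1 - Real.exp (-‖v‖ ^ 2 / (8 * t))) := by
  have hg : Integrable fun z : EuclideanSpace ℝ (Fin n) ↦
      Real.exp (-(1 / (2 * t)) * ‖z‖ ^ 2) := by
    refine Integrable.of_integral_ne_zero ?_
    rw [GaussianFourier.integral_rexp_neg_mul_sq_norm (by positivity)]
    positivity
  have h₁ := hg.comp_sub_left v
  have h₃ := (hg.comp_sub_right ((1 / 2 : ℝ) • v)).const_mul (2 * Real.exp (-‖v‖ ^ 2 / (8 * t)))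
  simp_rw [weierstrass_sub_sq n ht v]
  rw [integral_const_mul, integral_sub (by exact h₁.add hg) h₃, integral_add h₁ hg, integral_const_mul,
    integral_sub_left_eq_self (fun z : EuclideanSpace ℝ (Fin n) ↦
      Real.exp (-(1 / (2 * t)) * ‖z‖ ^ 2)) volume v,
    integral_sub_right_eq_self (fun z : EuclideanSpace ℝ (Fin n) ↦
      Real.exp (-(1 / (2 * t)) * ‖z‖ ^ 2))]
  ring

/-- Closed form of the radial profile, up to a positive constant. -/
lemma exists_diffProfile_eq_sqrt (n : ℕ) [NeZero n] {t : ℝ} (ht : 0 < t) :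
    ∃ K : ℝ, 0 < K ∧
      diffProfile n t = fun r ↦ Real.sqrt (K * (1 - Real.exp (-r ^ 2 / (8 * t)))) := by
  refine ⟨2 * ((4 * Real.pi * t) ^ (-(n : ℝ) / 2)) ^ 2 *
    ∫ z : EuclideanSpace ℝ (Fin n), Real.exp (-(1 / (2 * t)) * ‖z‖ ^ 2), ?_, ?_⟩
  · rw [GaussianFourier.integral_rexp_neg_mul_sq_norm (by positivity)]
    positivity
  · funext r
    rw [diffProfile, integral_weierstrass_sub_sq n ht]
    simp [norm_smul]

/-- For each fixed `t > 0`, the radial profile `ρ_t` is continuous on `[0,∞)`,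
vanishes at `0`, and is strictly increasing on `[0,∞)`. -/
theorem diffProfile_continuous_zero_strictMono (n : ℕ) [NeZero n] (t : ℝ) (ht : 0 < t) :
    ContinuousOn (diffProfile n t) (Set.Ici 0) ∧
    diffProfile n t 0 = 0 ∧
    StrictMonoOn (diffProfile n t) (Set.Ici 0) := by
  obtain ⟨K, hK, h⟩ := exists_diffProfile_eq_sqrt n ht
  rw [h]
  refine ⟨Continuous.continuousOn (by fun_prop), by simp, fun r hr s _ hrs ↦ ?_⟩
  have hr₀ : 0 ≤ r := hr
  refine Real.sqrt_lt_sqrt (mul_nonneg hK.le (sub_nonneg.2 (Real.exp_le_one_iff.2 ?_))) ?_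
  · exact div_nonpos_of_nonpos_of_nonneg (neg_nonpos.2 (sq_nonneg r)) (by positivity)
  · gcongr
end

section
/- For any t₁ > 0 and t₂ > 0, the radial profiles satisfy lim_{r→0⁺} ρ_{t₁}(r)/ρ_{t₂}(r) = (t₂/t₁)^{n/4 + 1/2}. -/
open MeasureTheory Real Filter

theorem integral_sq_weierstrass (n : ℕ) {t : ℝ} (ht : 0 < t) :
    ∫ z, weierstrass n t z ^ 2 = (8 * π * t) ^ (-(n : ℝ) / 2) := by
  have h (z : EuclideanSpace ℝ (Fin n)) : weierstrass n t z ^ 2 =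
      (4 * π * t) ^ (-(n : ℝ)) * Real.exp (-(1 / (2 * t)) * ‖z‖ ^ 2) := by
    rw [weierstrass, mul_pow, ← Real.rpow_mul_natCast (by positivity), ← Real.exp_nat_mul]
    congr 2
    · push_cast; ring
    · push_cast; field_simp; ring
  simp_rw [h]
  rw [integral_const_mul, GaussianFourier.integral_rexp_neg_mul_sq_norm (by positivity)]
  have h4 : (4 * π * t) ^ (-(n : ℝ)) = ((4 * π * t) ^ 2) ^ (-(n : ℝ) / 2) := by
    rw [← Real.rpow_natCast_mul (by positivity)]
    congr 1; push_cast; ring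
  have h2 : (π / (1 / (2 * t))) ^ ((n : ℝ) / 2) = ((2 * π * t)⁻¹) ^ (-(n : ℝ) / 2) := by
    rw [Real.inv_rpow (by positivity), ← Real.rpow_neg (by positivity)]
    congr 1
    · field_simp
    · ring
  rw [finrank_euclideanSpace_fin, h4, h2, ← Real.mul_rpow (by positivity) (by positivity)]
  congr 1
  field_simp
  ring

theorem integrable_sq_weierstrass (n : ℕ) {t : ℝ} (ht : 0 < t) :
    Integrable (fun z => weierstrass n t z ^ 2) := by
  refine Integrable.of_integral_ne_zero ?_
  rw [integral_sq_weierstrass n ht]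
  positivity

theorem weierstrass_sub_mul_weierstrass (n : ℕ) {t : ℝ} (ht : 0 < t)
    (a z : EuclideanSpace ℝ (Fin n)) :
    weierstrass n t (a - z) * weierstrass n t z =
      Real.exp (-(‖a‖ ^ 2 / (8 * t))) * weierstrass n t (z - (1 / 2 : ℝ) • a) ^ 2 := by
  have hexp : -‖a - z‖ ^ 2 / (4 * t) + -‖z‖ ^ 2 / (4 * t) =
      -(‖a‖ ^ 2 / (8 * t)) +
        (-‖z - (1 / 2 : ℝ) • a‖ ^ 2 / (4 * t) + -‖z - (1 / 2 : ℝ) • a‖ ^ 2 / (4 * t)) := by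
    rw [norm_sub_sq_real a z, norm_sub_sq_real z, inner_smul_right, norm_smul, real_inner_comm,
      Real.norm_of_nonneg (by norm_num : (0 : ℝ) ≤ 1 / 2)]
    field_simp
    ring
  have h := congrArg Real.exp hexp
  simp only [Real.exp_add] at h
  simp only [weierstrass]
  linear_combination ((4 * π * t) ^ (-(n : ℝ) / 2)) ^ 2 * h

theorem integral_sq_weierstrass_sub (n : ℕ) {t : ℝ} (ht : 0 < t)
    (a : EuclideanSpace ℝ (Fin n)) :
    ∫ z, |weierstrass n t (a - z) - weierstrass n t z| ^ 2 =
      2 * (8 * π * t) ^ (-(n : ℝ) / 2) * (1 - Real.exp (-(‖a‖ ^ 2 / (8 * t)))) := by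
  have hi := integrable_sq_weierstrass n ht
  have h (z : EuclideanSpace ℝ (Fin n)) :
      |weierstrass n t (a - z) - weierstrass n t z| ^ 2 =
        weierstrass n t (a - z) ^ 2 + weierstrass n t z ^ 2 -
          2 * Real.exp (-(‖a‖ ^ 2 / (8 * t))) * weierstrass n t (z - (1 / 2 : ℝ) • a) ^ 2 := by
    rw [sq_abs]
    linear_combination (-2) * weierstrass_sub_mul_weierstrass n ht a z
  simp_rw [h]
  have hl := hi.comp_sub_left a
  have hr := (hi.comp_sub_right ((1 / 2 : ℝ) • a)).const_mul
    (2 * Real.exp (-(‖a‖ ^ 2 / (8 * t))))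
  have hs : Integrable (fun z => weierstrass n t (a - z) ^ 2 + weierstrass n t z ^ 2) :=
    hl.add hi
  rw [integral_sub hs hr, integral_add hl hi, integral_const_mul,
    integral_sub_left_eq_self (fun z => weierstrass n t z ^ 2),
    integral_sub_right_eq_self (fun z => weierstrass n t z ^ 2), integral_sq_weierstrass n ht]
  ring

theorem diffProfile_eq (n : ℕ) [NeZero n] {t : ℝ} (ht : 0 < t) (r : ℝ) :
    diffProfile n t r =
      √(2 * (8 * π * t) ^ (-(n : ℝ) / 2) * (1 - Real.exp (-(r ^ 2 / (8 * t))))) := by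
  rw [diffProfile, integral_sq_weierstrass_sub n ht]
  simp [norm_smul]

theorem tendsto_one_sub_exp_neg_div {c : ℝ} :
    Tendsto (fun s : ℝ => (1 - Real.exp (-(s / c))) / s) (nhdsWithin 0 {0}ᶜ) (nhds (1 / c)) := by
  have h : HasDerivAt (fun s : ℝ => 1 - Real.exp (-(s / c))) (1 / c) 0 := by
    simpa using (((hasDerivAt_id (0 : ℝ)).div_const c).neg.exp.const_sub 1)
  refine h.tendsto_slope.congr fun s => ?_
  simp [slope_def_field]

/-- For `t₁, t₂ > 0`, `lim_{r→0⁺} ρ_{t₁}(r)/ρ_{t₂}(r) = (t₂/t₁)^{n/4 + 1/2}`. -/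
theorem diffProfile_ratio_limit (n : ℕ) [NeZero n] (t₁ t₂ : ℝ) (ht₁ : 0 < t₁) (ht₂ : 0 < t₂) :
    Tendsto (fun r : ℝ => diffProfile n t₁ r / diffProfile n t₂ r)
      (nhdsWithin 0 (Set.Ioi 0))
      (nhds ((t₂ / t₁) ^ ((n : ℝ) / 4 + 1 / 2))) := by
  have hsq : Tendsto (fun r : ℝ => r ^ 2) (nhdsWithin 0 (Set.Ioi 0)) (nhdsWithin 0 {0}ᶜ) := by
    refine tendsto_nhdsWithin_iff.2 ⟨?_, ?_⟩
    · exact ((continuous_pow 2).tendsto' (0 : ℝ) 0 (by simp)).mono_left nhdsWithin_le_nhds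
    · filter_upwards [self_mem_nhdsWithin] with r hr
      exact pow_ne_zero 2 (ne_of_gt hr)
  have hlim (t : ℝ) := ((tendsto_one_sub_exp_neg_div (c := 8 * t)).comp hsq).const_mul
    (2 * (8 * π * t) ^ (-(n : ℝ) / 2))
  have key := ((hlim t₁).div (hlim t₂) (by positivity)).sqrt
  have hval : √(2 * (8 * π * t₁) ^ (-(n : ℝ) / 2) * (1 / (8 * t₁)) /
      (2 * (8 * π * t₂) ^ (-(n : ℝ) / 2) * (1 / (8 * t₂)))) =
      (t₂ / t₁) ^ ((n : ℝ) / 4 + 1 / 2) := by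
    have hpow : (8 * π * t₁) ^ (-(n : ℝ) / 2) =
        (t₂ / t₁) ^ ((n : ℝ) / 2) * (8 * π * t₂) ^ (-(n : ℝ) / 2) := by
      have h : 8 * π * t₁ = (t₂ / t₁)⁻¹ * (8 * π * t₂) := by field_simp
      rw [h, Real.mul_rpow (by positivity) (by positivity), Real.inv_rpow (by positivity),
        ← Real.rpow_neg (by positivity), neg_div, neg_neg]
    have h : 2 * (8 * π * t₁) ^ (-(n : ℝ) / 2) * (1 / (8 * t₁)) /
        (2 * (8 * π * t₂) ^ (-(n : ℝ) / 2) * (1 / (8 * t₂))) =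
        (t₂ / t₁) ^ ((n : ℝ) / 2 + 1) := by
      have hne : (8 * π * t₂) ^ (-(n : ℝ) / 2) ≠ 0 := by positivity
      rw [hpow, Real.rpow_add_one (by positivity)]
      generalize (8 * π * t₂) ^ (-(n : ℝ) / 2) = x at *
      generalize (t₂ / t₁) ^ ((n : ℝ) / 2) = y
      field_simp
    rw [h, Real.sqrt_eq_rpow, ← Real.rpow_mul (by positivity)]
    congr 1
    ring
  rw [hval] at key
  refine key.congr' ?_
  filter_upwards [self_mem_nhdsWithin] with r hr
  have hr' : r ^ 2 ≠ 0 := pow_ne_zero 2 (ne_of_gt hr)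
  have hnonneg : 0 ≤ 1 - Real.exp (-(r ^ 2 / (8 * t₁))) := by
    rw [sub_nonneg, Real.exp_le_one_iff, neg_nonpos]
    positivity
  rw [diffProfile_eq n ht₁, diffProfile_eq n ht₂, ← Real.sqrt_div (by positivity)]
  simp only [Pi.div_apply, Function.comp_apply, ← mul_div_assoc]
  rw [div_div_div_cancel_right₀ hr']
end

section
/- For every s > 0, t > 0 and every pair of distinct points x, y ∈ ℝ⁺, the series defining the dyadic diffusion kernel converges absolutely: the only nonzero terms e^{−t|I(h)|^{-s}} h(x) h(y) come from Haar functions h whose supporting interval I(h) contains the smallest dyadic interval I(x,y) containing x and y, one has Σ_{I ∈ 𝒟, I ⊇ I(x,y)} |I|^{-1} = 2/δ(x,y), and hence Σ_{h ∈ ℋ} e^{−t|I(h)|^{-s}} |h(x)| |h(y)| ≤ 2/δ(x,y). -/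
open Real Set
open scoped Classical

/-- The dyadic interval `I^j_k = [k 2^{-j}, (k+1) 2^{-j}) ⊂ ℝ⁺`, `j ∈ ℤ`, `k ∈ ℕ₀`. -/
def dyadicI (j : ℤ) (k : ℕ) : Set ℝ :=
  Set.Ico ((k : ℝ) * (2 : ℝ) ^ (-j)) (((k : ℝ) + 1) * (2 : ℝ) ^ (-j))

/-- The dyadic distance `δ(x,y) = inf {|I| : I dyadic interval containing x and y}`. -/
noncomputable def dyadicDist (x y : ℝ) : ℝ :=
  if x = y then 0
  else sInf {l : ℝ | ∃ (j : ℤ) (k : ℕ), l = (2 : ℝ) ^ (-j) ∧ x ∈ dyadicI j k ∧ y ∈ dyadicI j k}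

/-- The mother Haar wavelet `h = χ_{[0,1/2)} - χ_{[1/2,1)}`. -/
noncomputable def motherHaar (x : ℝ) : ℝ :=
  if 0 ≤ x ∧ x < 1 / 2 then 1 else if 1 / 2 ≤ x ∧ x < 1 then -1 else 0

/-- The Haar wavelet `h^j_k(x) = 2^{j/2} h(2^j x - k)`, supported on `I^j_k`. -/
noncomputable def haarFn (j : ℤ) (k : ℕ) (x : ℝ) : ℝ :=
  (2 : ℝ) ^ ((j : ℝ) / 2) * motherHaar ((2 : ℝ) ^ j * x - (k : ℝ))

theorem mem_dyadicI_iff (j : ℤ) (k : ℕ) (x : ℝ) :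
    x ∈ dyadicI j k ↔ 0 ≤ x ∧ ⌊x * 2 ^ j⌋₊ = k := by
  have h2 : (0 : ℝ) < 2 ^ j := by positivity
  have hmem : x ∈ dyadicI j k ↔ (k : ℝ) ≤ x * 2 ^ j ∧ x * 2 ^ j < k + 1 := by
    rw [dyadicI, Set.mem_Ico, zpow_neg, ← div_eq_mul_inv, ← div_eq_mul_inv, div_le_iff₀ h2,
      lt_div_iff₀ h2]
  rw [hmem]
  constructor
  · intro h
    have hx : 0 ≤ x * 2 ^ j := (Nat.cast_nonneg k).trans h.1
    exact ⟨nonneg_of_mul_nonneg_left hx h2, (Nat.floor_eq_iff hx).2 h⟩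
  · rintro ⟨hx, h⟩
    exact (Nat.floor_eq_iff (by positivity)).1 h

theorem floor_mul_zpow_sub_natCast (x : ℝ) (j : ℤ) (n : ℕ) :
    ⌊x * 2 ^ (j - n)⌋₊ = ⌊x * 2 ^ j⌋₊ / 2 ^ n := by
  rw [← Nat.floor_div_natCast]
  congr 1
  rw [zpow_sub₀ two_ne_zero, zpow_natCast, mul_div_assoc]
  norm_num

theorem floor_mul_zpow_eq_of_le {x y : ℝ} {i j : ℤ} (hij : i ≤ j)
    (h : ⌊x * 2 ^ j⌋₊ = ⌊y * 2 ^ j⌋₊) : ⌊x * 2 ^ i⌋₊ = ⌊y * 2 ^ i⌋₊ := by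
  obtain ⟨n, rfl⟩ : ∃ n : ℕ, i = j - n := ⟨(j - i).toNat, by omega⟩
  rw [floor_mul_zpow_sub_natCast, floor_mul_zpow_sub_natCast, h]

theorem exists_zpow_mul_lt_one (x : ℝ) : ∃ j : ℤ, x * 2 ^ j < 1 := by
  obtain ⟨n, hn⟩ := pow_unbounded_of_one_lt x one_lt_two
  refine ⟨-n, ?_⟩
  rw [zpow_neg, zpow_natCast, ← div_eq_mul_inv, div_lt_one (by positivity)]
  exact hn

/-- Two distinct points share their dyadic interval exactly up to some finest scale. -/
theorem exists_finest_common_scale {x y : ℝ} (hx : 0 ≤ x) (hy : 0 ≤ y) (hxy : x ≠ y) :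
    ∃ j₀ : ℤ, ∀ j : ℤ, ⌊x * 2 ^ j⌋₊ = ⌊y * 2 ^ j⌋₊ ↔ j ≤ j₀ := by
  have hd : 0 < |x - y| := abs_pos.2 (sub_ne_zero.2 hxy)
  have hbdd : ∃ b : ℤ, ∀ j : ℤ, ⌊x * 2 ^ j⌋₊ = ⌊y * 2 ^ j⌋₊ → j ≤ b := by
    obtain ⟨i, hi⟩ := exists_zpow_mul_lt_one |x - y|⁻¹
    refine ⟨-i, fun j hj => ?_⟩
    by_contra! hlt
    have h2 : (0 : ℝ) < 2 ^ j := by positivity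
    have hx1 := Nat.floor_le (a := x * 2 ^ j) (by positivity)
    have hx2 := Nat.lt_floor_add_one (x * 2 ^ j)
    have hy1 := Nat.floor_le (a := y * 2 ^ j) (by positivity)
    have hy2 := Nat.lt_floor_add_one (y * 2 ^ j)
    rw [hj] at hx1 hx2
    have hclose : |x - y| * 2 ^ j < 1 := by
      rw [← abs_of_pos h2, ← abs_mul, sub_mul, abs_lt]
      constructor <;> linarith
    have hi' : (2 : ℝ) ^ i < |x - y| := by
      rwa [inv_mul_lt_iff₀ hd, mul_one] at hi
    have hle : (1 : ℝ) ≤ 2 ^ i * 2 ^ j := by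
      rw [← zpow_add₀ two_ne_zero]
      exact one_le_zpow₀ one_le_two (by omega)
    nlinarith
  have hne : ∃ j : ℤ, ⌊x * 2 ^ j⌋₊ = ⌊y * 2 ^ j⌋₊ := by
    obtain ⟨j, hj⟩ := exists_zpow_mul_lt_one (x + y)
    have h2 : (0 : ℝ) < 2 ^ j := by positivity
    refine ⟨j, ?_⟩
    rw [Nat.floor_eq_zero.2 (by nlinarith), Nat.floor_eq_zero.2 (by nlinarith)]
  obtain ⟨j₀, hj₀, hmax⟩ := Int.exists_greatest_of_bdd hbdd hne
  exact ⟨j₀, fun j => ⟨hmax j, fun h => floor_mul_zpow_eq_of_le h hj₀⟩⟩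

theorem abs_haarFn (j : ℤ) (k : ℕ) (x : ℝ) :
    |haarFn j k x| = if x ∈ dyadicI j k then (2 : ℝ) ^ ((j : ℝ) / 2) else 0 := by
  have h2 : (0 : ℝ) < 2 ^ j := by positivity
  have hmem : x ∈ dyadicI j k ↔ 0 ≤ 2 ^ j * x - (k : ℝ) ∧ 2 ^ j * x - (k : ℝ) < 1 := by
    rw [dyadicI, Set.mem_Ico, zpow_neg, ← div_eq_mul_inv, ← div_eq_mul_inv, div_le_iff₀ h2,
      lt_div_iff₀ h2, mul_comm x, sub_nonneg, sub_lt_iff_lt_add']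
  have hpos : (0 : ℝ) < 2 ^ ((j : ℝ) / 2) := by positivity
  rw [haarFn, abs_mul, abs_of_pos hpos, hmem, motherHaar]
  split_ifs <;> first | (simp; done) | (exfalso; grind)

theorem abs_haarFn_mul_abs_haarFn (j : ℤ) (k : ℕ) (x y : ℝ) :
    |haarFn j k x| * |haarFn j k y| =
      if x ∈ dyadicI j k ∧ y ∈ dyadicI j k then (2 : ℝ) ^ j else 0 := by
  have h : (2 : ℝ) ^ ((j : ℝ) / 2) * 2 ^ ((j : ℝ) / 2) = 2 ^ j := by
    rw [← Real.rpow_add two_pos, add_halves, Real.rpow_intCast]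
  rw [abs_haarFn, abs_haarFn, ite_zero_mul_ite_zero, h]

/-- Summing reciprocal lengths over the dyadic ancestors of a point above scale `j₀`. -/
theorem hasSum_inv_length_ancestors (x : ℝ) (j₀ : ℤ) :
    HasSum (fun p : ℤ × ℕ =>
      if p.1 ≤ j₀ ∧ ⌊x * 2 ^ p.1⌋₊ = p.2 then ((2 : ℝ) ^ (-p.1))⁻¹ else 0) (2 * 2 ^ j₀) := by
  let g : ℕ → ℤ × ℕ := fun n => (j₀ - n, ⌊x * 2 ^ (j₀ - n : ℤ)⌋₊)
  have hg : Function.Injective g := fun m n h => by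
    have := congrArg Prod.fst h
    simp only [g] at this
    omega
  rw [← hg.hasSum_iff]
  · refine (congrArg (HasSum · (2 * 2 ^ j₀)) (funext fun n => ?_)).mpr
      (hasSum_geometric_two.mul_right ((2 : ℝ) ^ j₀))
    have hn : j₀ - (n : ℤ) ≤ j₀ := by omega
    rw [Function.comp_apply, if_pos ⟨hn, rfl⟩, zpow_neg, inv_inv, zpow_sub₀ two_ne_zero,
      zpow_natCast]
    simp [div_eq_mul_inv, mul_comm]
  · rintro ⟨j, k⟩ hp
    refine if_neg fun h => hp ⟨(j₀ - j).toNat, ?_⟩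
    have hj : j₀ - ((j₀ - j).toNat : ℤ) = j := by have := h.1; omega
    simp only [g, hj, h.2]

/-- Absolute convergence of the series defining the dyadic diffusion kernel: the only nonzero
terms come from Haar functions whose supporting interval contains `I(x,y)`, the lengths of the
dyadic intervals containing `I(x,y)` sum (reciprocally) to `2/δ(x,y)`, and hence
`Σ_h e^{-t|I(h)|^{-s}} |h(x)||h(y)| ≤ 2/δ(x,y)`. -/
theorem dyadic_kernel_abs_convergence (s t : ℝ) (hs : 0 < s) (ht : 0 < t)
    (x y : ℝ) (hx : 0 ≤ x) (hy : 0 ≤ y) (hxy : x ≠ y) :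
    ∃ (j₀ : ℤ) (k₀ : ℕ), x ∈ dyadicI j₀ k₀ ∧ y ∈ dyadicI j₀ k₀ ∧
      (∀ (j : ℤ) (k : ℕ), x ∈ dyadicI j k → y ∈ dyadicI j k → dyadicI j₀ k₀ ⊆ dyadicI j k) ∧
      (∀ (j : ℤ) (k : ℕ),
        Real.exp (-t * ((2 : ℝ) ^ (-j)) ^ (-s)) * haarFn j k x * haarFn j k y ≠ 0 →
          dyadicI j₀ k₀ ⊆ dyadicI j k) ∧
      (∑' p : ℤ × ℕ,
        (if dyadicI j₀ k₀ ⊆ dyadicI p.1 p.2 then ((2 : ℝ) ^ (-p.1))⁻¹ else 0))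
        = 2 / dyadicDist x y ∧
      Summable (fun p : ℤ × ℕ =>
        Real.exp (-t * ((2 : ℝ) ^ (-p.1)) ^ (-s)) * |haarFn p.1 p.2 x| * |haarFn p.1 p.2 y|) ∧
      (∑' p : ℤ × ℕ,
        Real.exp (-t * ((2 : ℝ) ^ (-p.1)) ^ (-s)) * |haarFn p.1 p.2 x| * |haarFn p.1 p.2 y|)
        ≤ 2 / dyadicDist x y := by
  obtain ⟨j₀, hj₀⟩ := exists_finest_common_scale hx hy hxy
  have hxm : x ∈ dyadicI j₀ ⌊x * 2 ^ j₀⌋₊ := (mem_dyadicI_iff _ _ _).2 ⟨hx, rfl⟩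
  have hym : y ∈ dyadicI j₀ ⌊x * 2 ^ j₀⌋₊ :=
    (mem_dyadicI_iff _ _ _).2 ⟨hy, ((hj₀ j₀).2 le_rfl).symm⟩
  have hboth (j : ℤ) (k : ℕ) :
      x ∈ dyadicI j k ∧ y ∈ dyadicI j k ↔ j ≤ j₀ ∧ ⌊x * 2 ^ j⌋₊ = k := by
    rw [mem_dyadicI_iff, mem_dyadicI_iff, ← hj₀]
    grind
  have hsub (j : ℤ) (k : ℕ) :
      dyadicI j₀ ⌊x * 2 ^ j₀⌋₊ ⊆ dyadicI j k ↔ j ≤ j₀ ∧ ⌊x * 2 ^ j⌋₊ = k := by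
    refine ⟨fun h => (hboth j k).1 ⟨h hxm, h hym⟩, fun h z hz => ?_⟩
    rw [mem_dyadicI_iff] at hz ⊢
    exact ⟨hz.1, (floor_mul_zpow_eq_of_le h.1 hz.2).trans h.2⟩
  have hdist : dyadicDist x y = 2 ^ (-j₀) := by
    rw [dyadicDist, if_neg hxy]
    refine IsLeast.csInf_eq ⟨⟨j₀, _, rfl, hxm, hym⟩, ?_⟩
    rintro l ⟨j, k, rfl, h⟩
    exact zpow_le_zpow_right₀ one_le_two (neg_le_neg ((hboth j k).1 h).1)
  have hval : 2 / dyadicDist x y = 2 * 2 ^ j₀ := by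
    rw [hdist, zpow_neg, div_inv_eq_mul]
  have hsum := hasSum_inv_length_ancestors x j₀
  have hnonneg (p : ℤ × ℕ) : 0 ≤
      Real.exp (-t * ((2 : ℝ) ^ (-p.1)) ^ (-s)) * |haarFn p.1 p.2 x| * |haarFn p.1 p.2 y| := by
    positivity
  have hle (p : ℤ × ℕ) :
      Real.exp (-t * ((2 : ℝ) ^ (-p.1)) ^ (-s)) * |haarFn p.1 p.2 x| * |haarFn p.1 p.2 y| ≤
        if p.1 ≤ j₀ ∧ ⌊x * 2 ^ p.1⌋₊ = p.2 then ((2 : ℝ) ^ (-p.1))⁻¹ else 0 := by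
    have hexp : Real.exp (-t * ((2 : ℝ) ^ (-p.1)) ^ (-s)) ≤ 1 :=
      Real.exp_le_one_iff.2 (mul_nonpos_of_nonpos_of_nonneg (by linarith) (by positivity))
    rw [mul_assoc, abs_haarFn_mul_abs_haarFn, zpow_neg, inv_inv]
    simp only [hboth]
    rw [← zpow_neg]
    exact mul_le_of_le_one_left (by positivity) hexp
  have hsummable := Summable.of_nonneg_of_le hnonneg hle hsum.summable
  refine ⟨j₀, ⌊x * 2 ^ j₀⌋₊, hxm, hym, fun j k h₁ h₂ => (hsub j k).2 ((hboth j k).1 ⟨h₁, h₂⟩),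
    fun j k h => (hsub j k).2 ((hboth j k).1 ?_), ?_, hsummable, ?_⟩
  · by_contra hn
    have h0 := abs_haarFn_mul_abs_haarFn j k x y
    rw [if_neg hn, ← abs_mul, abs_eq_zero] at h0
    exact h (by rw [mul_assoc, h0, mul_zero])
  · simp only [hsub]
    rw [hval]
    exact hsum.tsum_eq
  · rw [hval, ← hsum.tsum_eq]
    exact hsummable.tsum_le_tsum hle hsum.summable
end

section
/- For every s > 0 and t > 0, the function d_t(x,y) = (Σ_{h ∈ ℋ} e^{−2t|I(h)|^{-s}} |h(x) − h(y)|²)^{1/2} is finite for all x, y ∈ ℝ⁺ and is a metric on ℝ⁺: it is nonnegative, symmetric, satisfies the triangle inequality, and d_t(x,y) = 0 if and only if x = y. -/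
open Real Set

/-- The fractional dyadic diffusion distance
`d_t(x,y) = (Σ_h e^{-2t|I(h)|^{-s}} |h(x) - h(y)|²)^{1/2}`. -/
noncomputable def dyadicDt (s t x y : ℝ) : ℝ :=
  Real.sqrt (∑' p : ℤ × ℕ,
    Real.exp (-2 * t * ((2 : ℝ) ^ (-p.1)) ^ (-s)) * (haarFn p.1 p.2 x - haarFn p.1 p.2 y) ^ 2)

lemma motherHaar_eq_zero_iff (u : ℝ) : motherHaar u = 0 ↔ ¬ (0 ≤ u ∧ u < 1) := by
  unfold motherHaar
  split_ifs with h₁ h₂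
  · simp only [one_ne_zero, false_iff, not_not]
    exact ⟨h₁.1, by linarith [h₁.2]⟩
  · simp only [neg_eq_zero, one_ne_zero, false_iff, not_not]
    exact ⟨by linarith [h₂.1], h₂.2⟩
  · simp only [true_iff]
    rintro ⟨h₀, h₁'⟩
    rcases lt_or_ge u (1 / 2) with h | h
    · exact h₁ ⟨h₀, h⟩
    · exact h₂ ⟨h, h₁'⟩

lemma motherHaar_sq_le_one (u : ℝ) : motherHaar u ^ 2 ≤ 1 := by
  unfold motherHaar
  split_ifs <;> norm_num

lemma haarFn_eq_zero_iff (j : ℤ) (k : ℕ) {x : ℝ} (hx : 0 ≤ x) :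
    haarFn j k x = 0 ↔ k ≠ ⌊(2 : ℝ) ^ j * x⌋₊ := by
  have h2 : (2 : ℝ) ^ ((j : ℝ) / 2) ≠ 0 := by positivity
  rw [haarFn, mul_eq_zero, or_iff_right h2, motherHaar_eq_zero_iff, not_iff_not,
    eq_comm, Nat.floor_eq_iff (by positivity), sub_nonneg, sub_lt_iff_lt_add']

lemma haarFn_sq_le (j : ℤ) (k : ℕ) (x : ℝ) : haarFn j k x ^ 2 ≤ (2 : ℝ) ^ j := by
  have h : ((2 : ℝ) ^ ((j : ℝ) / 2)) ^ 2 = (2 : ℝ) ^ j := by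
    rw [← Real.rpow_natCast, ← Real.rpow_mul (by norm_num), ← Real.rpow_intCast]
    congr 1
    push_cast
    ring
  rw [haarFn, mul_pow, h]
  exact mul_le_of_le_one_right (by positivity) (motherHaar_sq_le_one _)

lemma summable_exp_neg_mul_pow_mul_two_pow {c r : ℝ} (hc : 0 < c) (hr : 1 < r) :
    Summable (fun n : ℕ => Real.exp (-(c * r ^ n)) * (2 : ℝ) ^ n) := by
  obtain ⟨m, hm⟩ := pow_unbounded_of_one_lt 4 hr
  refine Summable.of_nonneg_of_le (fun n => by positivity) (fun n => ?_)
    ((summable_geometric_of_lt_one (r := (1 / 2 : ℝ)) (by norm_num) (by norm_num)).mul_left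
      (m.factorial / c ^ m))
  have hr0 : 0 < r := by linarith
  have h₁ : c ^ m * 4 ^ n / m.factorial ≤ Real.exp (c * r ^ n) := by
    refine le_trans ?_ (Real.pow_div_factorial_le_exp (c * r ^ n) (by positivity) m)
    rw [mul_pow, ← pow_mul, mul_comm n m, pow_mul]
    gcongr
  have h₂ : Real.exp (-(c * r ^ n)) ≤ m.factorial / (c ^ m * 4 ^ n) := by
    rw [Real.exp_neg, ← inv_div]
    exact inv_anti₀ (by positivity) h₁
  calc Real.exp (-(c * r ^ n)) * (2 : ℝ) ^ n
      ≤ m.factorial / (c ^ m * 4 ^ n) * 2 ^ n := by gcongr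
    _ = m.factorial / c ^ m * (1 / 2) ^ n := by
      rw [show (4 : ℝ) = 2 * 2 by norm_num, mul_pow, one_div, inv_pow]
      field_simp

lemma summable_exp_neg_mul_rpow_mul_two_zpow {s t : ℝ} (hs : 0 < s) (ht : 0 < t) :
    Summable (fun j : ℤ =>
      Real.exp (-2 * t * ((2 : ℝ) ^ (-j)) ^ (-s)) * (2 : ℝ) ^ j) := by
  refine Summable.of_nat_of_neg ?_ ?_
  · refine (summable_exp_neg_mul_pow_mul_two_pow (c := 2 * t) (r := 2 ^ s) (by positivity)
      (Real.one_lt_rpow (by norm_num) hs)).congr fun n => ?_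
    have h : ((2 : ℝ) ^ (-(n : ℤ))) ^ (-s) = ((2 : ℝ) ^ s) ^ n := by
      rw [← Real.rpow_intCast, ← Real.rpow_natCast, ← Real.rpow_mul (by norm_num),
        ← Real.rpow_mul (by norm_num)]
      congr 1
      push_cast
      ring
    rw [h, zpow_natCast]
    congr 2
    ring
  · refine Summable.of_nonneg_of_le (fun n => by positivity) (fun n => ?_)
      (summable_geometric_of_lt_one (r := (1 / 2 : ℝ)) (by norm_num) (by norm_num))
    rw [zpow_neg (2 : ℝ) (n : ℤ), zpow_natCast, one_div, inv_pow]
    refine mul_le_of_le_one_left (by positivity) (Real.exp_le_one_iff.2 ?_)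
    have : 0 ≤ t * ((2 : ℝ) ^ (-(-(n : ℤ)))) ^ (-s) := by positivity
    linarith

lemma summable_exp_mul_haarFn_sq {s t x : ℝ} (hs : 0 < s) (ht : 0 < t) (hx : 0 ≤ x) :
    Summable (fun p : ℤ × ℕ =>
      Real.exp (-2 * t * ((2 : ℝ) ^ (-p.1)) ^ (-s)) * haarFn p.1 p.2 x ^ 2) := by
  have hinj : Function.Injective (fun j : ℤ => (j, ⌊(2 : ℝ) ^ j * x⌋₊)) :=
    fun _ _ h => congrArg Prod.fst h
  refine (hinj.summable_iff ?_).1 ?_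
  · rintro ⟨j, k⟩ hp
    have : haarFn j k x = 0 := by
      rw [haarFn_eq_zero_iff j k hx]
      rintro rfl
      exact hp ⟨j, rfl⟩
    simp [this]
  · refine Summable.of_nonneg_of_le (fun j => by simp only [Function.comp]; positivity)
      (fun j => ?_) (summable_exp_neg_mul_rpow_mul_two_zpow hs ht)
    exact mul_le_mul_of_nonneg_left (haarFn_sq_le _ _ _) (Real.exp_pos _).le

lemma summable_exp_mul_haarFn_sub_sq {s t x y : ℝ} (hs : 0 < s) (ht : 0 < t)
    (hx : 0 ≤ x) (hy : 0 ≤ y) :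
    Summable (fun p : ℤ × ℕ =>
      Real.exp (-2 * t * ((2 : ℝ) ^ (-p.1)) ^ (-s)) *
        (haarFn p.1 p.2 x - haarFn p.1 p.2 y) ^ 2) := by
  refine Summable.of_nonneg_of_le (fun p => by positivity) (fun p => ?_)
    (((summable_exp_mul_haarFn_sq hs ht hx).add
      (summable_exp_mul_haarFn_sq hs ht hy)).mul_left 2)
  have := mul_nonneg (Real.exp_pos (-2 * t * ((2 : ℝ) ^ (-p.1)) ^ (-s))).le
    (sq_nonneg (haarFn p.1 p.2 x + haarFn p.1 p.2 y))
  linarith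

/-- Weighted Minkowski inequality for square-summable differences. -/
lemma sqrt_tsum_mul_sub_sq_le {ι : Type*} {w a b c : ι → ℝ} (hw : ∀ i, 0 ≤ w i)
    (hab : Summable fun i => w i * (a i - b i) ^ 2)
    (hbc : Summable fun i => w i * (b i - c i) ^ 2)
    (hac : Summable fun i => w i * (a i - c i) ^ 2) :
    √(∑' i, w i * (a i - c i) ^ 2) ≤
      √(∑' i, w i * (a i - b i) ^ 2) + √(∑' i, w i * (b i - c i) ^ 2) := by
  have hsq (u v : ι → ℝ) (i : ι) :
      (√(w i) * |u i - v i|) ^ (2 : ℝ) = w i * (u i - v i) ^ 2 := by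
    rw [Real.rpow_two, mul_pow, Real.sq_sqrt (hw i), sq_abs]
  have hnonneg (u v : ι → ℝ) (i : ι) : 0 ≤ √(w i) * |u i - v i| := by positivity
  obtain ⟨hsum, hle⟩ := Real.Lp_add_le_tsum_of_nonneg one_le_two (hnonneg a b) (hnonneg b c)
    (by simpa only [hsq] using hab) (by simpa only [hsq] using hbc)
  simp only [hsq, ← Real.sqrt_eq_rpow] at hle
  refine le_trans (Real.sqrt_le_sqrt (hac.tsum_le_tsum (fun i => ?_) hsum)) hle
  rw [← hsq]
  refine Real.rpow_le_rpow (hnonneg a c i) ?_ zero_le_two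
  rw [← mul_add]
  exact mul_le_mul_of_nonneg_left (abs_sub_le _ _ _) (Real.sqrt_nonneg _)

lemma exists_haarFn_ne {x y : ℝ} (hx : 0 ≤ x) (hxy : x < y) :
    ∃ p : ℤ × ℕ, haarFn p.1 p.2 x ≠ haarFn p.1 p.2 y := by
  obtain ⟨n, hn⟩ := pow_unbounded_of_one_lt (1 / (y - x)) (one_lt_two (α := ℝ))
  rw [div_lt_iff₀ (sub_pos.2 hxy)] at hn
  have hy : 0 ≤ y := hx.trans hxy.le
  refine ⟨(n, ⌊(2 : ℝ) ^ (n : ℤ) * x⌋₊), fun h => ?_⟩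
  have hx' : haarFn n ⌊(2 : ℝ) ^ (n : ℤ) * x⌋₊ x ≠ 0 := by
    simp [haarFn_eq_zero_iff _ _ hx]
  have hy' : haarFn n ⌊(2 : ℝ) ^ (n : ℤ) * x⌋₊ y = 0 := by
    rw [haarFn_eq_zero_iff _ _ hy]
    intro hfl
    have h₁ := Nat.floor_le (show 0 ≤ (2 : ℝ) ^ (n : ℤ) * x by positivity)
    have h₂ := Nat.lt_floor_add_one ((2 : ℝ) ^ (n : ℤ) * y)
    rw [← hfl] at h₂
    rw [zpow_natCast] at h₁ h₂
    linarith
  exact hx' (h.trans hy')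

lemma dyadicDt_comm (s t x y : ℝ) : dyadicDt s t x y = dyadicDt s t y x := by
  simp only [dyadicDt, sub_sq_comm]

lemma dyadicDt_ne_zero_of_lt {s t x y : ℝ} (hs : 0 < s) (ht : 0 < t) (hx : 0 ≤ x)
    (hxy : x < y) : dyadicDt s t x y ≠ 0 := by
  obtain ⟨p, hp⟩ := exists_haarFn_ne hx hxy
  refine (Real.sqrt_pos.2 ((summable_exp_mul_haarFn_sub_sq hs ht hx
    (hx.trans hxy.le)).tsum_pos (fun q => by positivity) p ?_)).ne'
  have := sub_ne_zero.2 hp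
  positivity

lemma dyadicDt_triangle {s t x y z : ℝ} (hs : 0 < s) (ht : 0 < t) (hx : 0 ≤ x) (hy : 0 ≤ y)
    (hz : 0 ≤ z) : dyadicDt s t x z ≤ dyadicDt s t x y + dyadicDt s t y z :=
  sqrt_tsum_mul_sub_sq_le
    (w := fun p : ℤ × ℕ => Real.exp (-2 * t * ((2 : ℝ) ^ (-p.1)) ^ (-s)))
    (a := fun p => haarFn p.1 p.2 x) (b := fun p => haarFn p.1 p.2 y)
    (c := fun p => haarFn p.1 p.2 z) (fun _ => (Real.exp_pos _).le)
    (summable_exp_mul_haarFn_sub_sq hs ht hx hy) (summable_exp_mul_haarFn_sub_sq hs ht hy hz)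
    (summable_exp_mul_haarFn_sub_sq hs ht hx hz)

/-- For every `s > 0` and `t > 0`, `d_t` is finite (the defining series is summable)
and is a metric on `ℝ⁺`. -/
theorem dyadicDt_is_metric (s t : ℝ) (hs : 0 < s) (ht : 0 < t) :
    (∀ x ∈ Set.Ici (0 : ℝ), ∀ y ∈ Set.Ici (0 : ℝ),
      Summable (fun p : ℤ × ℕ =>
        Real.exp (-2 * t * ((2 : ℝ) ^ (-p.1)) ^ (-s)) *
          (haarFn p.1 p.2 x - haarFn p.1 p.2 y) ^ 2)) ∧
    (∀ x ∈ Set.Ici (0 : ℝ), ∀ y ∈ Set.Ici (0 : ℝ), 0 ≤ dyadicDt s t x y) ∧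
    (∀ x ∈ Set.Ici (0 : ℝ), ∀ y ∈ Set.Ici (0 : ℝ), dyadicDt s t x y = dyadicDt s t y x) ∧
    (∀ x ∈ Set.Ici (0 : ℝ), ∀ y ∈ Set.Ici (0 : ℝ), ∀ z ∈ Set.Ici (0 : ℝ),
      dyadicDt s t x z ≤ dyadicDt s t x y + dyadicDt s t y z) ∧
    (∀ x ∈ Set.Ici (0 : ℝ), ∀ y ∈ Set.Ici (0 : ℝ), (dyadicDt s t x y = 0 ↔ x = y)) := by
  refine ⟨fun x hx y hy => summable_exp_mul_haarFn_sub_sq hs ht hx hy,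
    fun x _ y _ => Real.sqrt_nonneg _, fun x _ y _ => dyadicDt_comm s t x y,
    fun x hx y hy z hz => dyadicDt_triangle hs ht hx hy hz, fun x hx y hy => ⟨fun h => ?_, ?_⟩⟩
  · rcases lt_trichotomy x y with hxy | hxy | hxy
    · exact absurd h (dyadicDt_ne_zero_of_lt hs ht hx hxy)
    · exact hxy
    · exact absurd ((dyadicDt_comm s t y x).trans h) (dyadicDt_ne_zero_of_lt hs ht hy hxy)
  · rintro rfl
    simp [dyadicDt]
end

section
/- Fix s > 0 and t > 0, and for i ∈ ℤ set f(i) = ψ_t(2^i)²/2 = 2^{1−i} e^{−2t·2^{−is}} + Σ_{k ≥ 1−i} 2^{k} e^{−2t·2^{ks}}. Then for every i ∈ ℤ, f(i+1) − f(i) = 2^{−i} (e^{−2t·2^{−(i+1)s}} − e^{−2t·2^{−is}}) > 0; in particular ψ_t(2^i) < ψ_t(2^{i+1}) for all i ∈ ℤ, i.e. ψ_t is strictly increasing on the integer powers of 2. -/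
open Real

/-- `η_t(σ) = 2 e^{-2tσ} + Σ_{ℓ≥1} 2^ℓ e^{-2t 2^{sℓ} σ}`. -/
noncomputable def etaFn (s t σ : ℝ) : ℝ :=
  2 * Real.exp (-2 * t * σ) +
    ∑' l : ℕ, (2 : ℝ) ^ (l + 1) * Real.exp (-2 * t * (2 : ℝ) ^ (s * ((l : ℝ) + 1)) * σ)

/-- `ψ_t(λ) = √((2/λ) η_t(λ^{-s}))`. -/
noncomputable def psiFn (s t lam : ℝ) : ℝ :=
  Real.sqrt ((2 / lam) * etaFn s t (lam ^ (-s)))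

/-- `f(i) = ψ_t(2^i)²/2 = 2^{1-i} e^{-2t 2^{-is}} + Σ_{k ≥ 1-i} 2^k e^{-2t 2^{ks}}`
(the sum over `k ≥ 1-i` reindexed by `k = 1 - i + m`, `m ∈ ℕ`). -/
noncomputable def fDy (s t : ℝ) (i : ℤ) : ℝ :=
  (2 : ℝ) ^ (1 - i) * Real.exp (-2 * t * (2 : ℝ) ^ (-(i : ℝ) * s)) +
    ∑' m : ℕ, (2 : ℝ) ^ (1 - i + (m : ℤ)) *
      Real.exp (-2 * t * (2 : ℝ) ^ ((((1 - i + (m : ℤ)) : ℤ) : ℝ) * s))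

/-- A geometric sequence times a doubly exponentially decaying one is summable. -/
theorem summable_pow_mul_exp_neg_mul_pow {a c r : ℝ} (ha : a ≠ 0) (hc : 0 < c) (hr : 1 < r) :
    Summable fun m : ℕ => a ^ m * Real.exp (-c * r ^ m) := by
  refine summable_of_ratio_test_tendsto_lt_one (l := 0) one_pos
    (Filter.Eventually.of_forall fun m => by positivity) ?_
  have h₁ : Filter.Tendsto (fun m : ℕ => c * (r - 1) * r ^ m) Filter.atTop Filter.atTop :=
    (tendsto_pow_atTop_atTop_of_one_lt hr).const_mul_atTop (mul_pos hc (sub_pos.2 hr))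
  have h₂ := (Real.tendsto_exp_neg_atTop_nhds_zero.comp h₁).const_mul |a|
  rw [mul_zero] at h₂
  refine h₂.congr fun m => ?_
  have he : Real.exp (-c * r ^ (m + 1)) =
      Real.exp (-c * r ^ m) * Real.exp (-(c * (r - 1) * r ^ m)) := by
    rw [← Real.exp_add]
    ring_nf
  have ham : |a| ^ m ≠ 0 := pow_ne_zero _ (abs_ne_zero.2 ha)
  simp only [Function.comp_apply, norm_mul, norm_pow, Real.norm_eq_abs, Real.abs_exp]
  rw [he]
  field_simp
  ring

/-- The terms of the series in `fDy` are summable. -/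
theorem summable_fDy {s t : ℝ} (hs : 0 < s) (ht : 0 < t) (j : ℤ) :
    Summable fun m : ℕ => (2 : ℝ) ^ (j + (m : ℤ)) *
      Real.exp (-2 * t * (2 : ℝ) ^ (((j + (m : ℤ) : ℤ) : ℝ) * s)) := by
  have h := (summable_pow_mul_exp_neg_mul_pow (a := 2) (c := 2 * t * (2 : ℝ) ^ ((j : ℝ) * s))
    (r := (2 : ℝ) ^ s) two_ne_zero (by positivity)
    (Real.one_lt_rpow one_lt_two hs)).mul_left ((2 : ℝ) ^ j)
  refine h.congr fun m => ?_
  have : (2 : ℝ) ^ (((j + (m : ℤ) : ℤ) : ℝ) * s) = (2 : ℝ) ^ ((j : ℝ) * s) * ((2 : ℝ) ^ s) ^ m := by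
    rw [← Real.rpow_mul_natCast zero_le_two, ← Real.rpow_add two_pos]
    push_cast
    ring_nf
  rw [this, zpow_add₀ two_ne_zero, zpow_natCast]
  ring_nf

theorem etaFn_nonneg (s t σ : ℝ) : 0 ≤ etaFn s t σ :=
  add_nonneg (by positivity) (tsum_nonneg fun _ => by positivity)

/-- `f(i) = ψ_t(2^i)² / 2`. -/
theorem fDy_eq_psiFn_sq_div_two (s t : ℝ) (i : ℤ) :
    fDy s t i = psiFn s t ((2 : ℝ) ^ i) ^ 2 / 2 := by
  have hσ : ((2 : ℝ) ^ i) ^ (-s) = (2 : ℝ) ^ (-(i : ℝ) * s) := by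
    rw [← Real.rpow_intCast, ← Real.rpow_mul zero_le_two]
    ring_nf
  have h_inv : (2 : ℝ) / 2 ^ i / 2 = 2 ^ (-i) := by
    rw [zpow_neg]
    field_simp
  rw [psiFn, Real.sq_sqrt (mul_nonneg (by positivity) (etaFn_nonneg _ _ _)), mul_div_right_comm,
    h_inv, hσ, etaFn, fDy, mul_add, ← tsum_mul_left]
  congr 1
  · rw [sub_eq_neg_add, zpow_add_one₀ two_ne_zero, mul_assoc]
  · refine tsum_congr fun m => ?_
    have h_pow : (2 : ℝ) ^ (1 - i + (m : ℤ)) = 2 ^ (-i) * 2 ^ (m + 1) := by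
      rw [← zpow_natCast, ← zpow_add₀ two_ne_zero]
      congr 1
      push_cast
      ring
    have h_rpow : (2 : ℝ) ^ (((1 - i + (m : ℤ) : ℤ) : ℝ) * s) =
        2 ^ (s * ((m : ℝ) + 1)) * 2 ^ (-(i : ℝ) * s) := by
      rw [← Real.rpow_add two_pos]
      push_cast
      ring_nf
    rw [h_pow, h_rpow]
    simp only [mul_assoc]

/-- The increment of `f` between consecutive integers. -/
theorem fDy_add_one_sub {s t : ℝ} (hs : 0 < s) (ht : 0 < t) (i : ℤ) :
    fDy s t (i + 1) - fDy s t i =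
      (2 : ℝ) ^ (-i) * (Real.exp (-2 * t * (2 : ℝ) ^ ((-(i : ℝ) - 1) * s)) -
        Real.exp (-2 * t * (2 : ℝ) ^ (-(i : ℝ) * s))) := by
  have h_shift : 1 - (i + 1) = -i := by ring
  have h_succ (m : ℕ) : -i + ((m + 1 : ℕ) : ℤ) = 1 - i + (m : ℤ) := by
    push_cast
    ring
  have h_cast : -((i + 1 : ℤ) : ℝ) = -(i : ℝ) - 1 := by
    push_cast
    ring
  have h_two : (2 : ℝ) ^ (1 - i) = 2 ^ (-i) * 2 := by
    rw [sub_eq_neg_add, zpow_add_one₀ two_ne_zero]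
  rw [fDy, fDy, h_shift, (summable_fDy hs ht (-i)).tsum_eq_zero_add, h_cast, h_two]
  simp only [h_succ, Nat.cast_zero, add_zero, Int.cast_neg]
  ring

theorem fDy_add_one_sub_pos {s t : ℝ} (hs : 0 < s) (ht : 0 < t) (i : ℤ) :
    0 < fDy s t (i + 1) - fDy s t i := by
  rw [fDy_add_one_sub hs ht]
  refine mul_pos (by positivity) (sub_pos.2 (Real.exp_lt_exp.2 ?_))
  refine mul_lt_mul_of_neg_left ?_ (by linarith)
  exact Real.rpow_lt_rpow_of_exponent_lt one_lt_two (by nlinarith)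

/-- With `f(i) = ψ_t(2^i)²/2`, one has
`f(i+1) - f(i) = 2^{-i}(e^{-2t 2^{-(i+1)s}} - e^{-2t 2^{-is}}) > 0`; in particular `ψ_t`
is strictly increasing on the integer powers of 2. -/
theorem psi_strictly_increasing_on_powers_of_two (s t : ℝ) (hs : 0 < s) (ht : 0 < t) :
    (∀ i : ℤ, fDy s t i = psiFn s t ((2 : ℝ) ^ i) ^ 2 / 2) ∧
    (∀ i : ℤ, fDy s t (i + 1) - fDy s t i =
      (2 : ℝ) ^ (-i) * (Real.exp (-2 * t * (2 : ℝ) ^ ((-(i : ℝ) - 1) * s)) -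
        Real.exp (-2 * t * (2 : ℝ) ^ (-(i : ℝ) * s)))) ∧
    (∀ i : ℤ, 0 < fDy s t (i + 1) - fDy s t i) ∧
    (∀ i : ℤ, psiFn s t ((2 : ℝ) ^ i) < psiFn s t ((2 : ℝ) ^ (i + 1))) := by
  refine ⟨fDy_eq_psiFn_sq_div_two s t, fDy_add_one_sub hs ht, fDy_add_one_sub_pos hs ht,
    fun i => lt_of_pow_lt_pow_left₀ 2 (Real.sqrt_nonneg _) ?_⟩
  have h := fDy_add_one_sub_pos hs ht i
  rw [fDy_eq_psiFn_sq_div_two, fDy_eq_psiFn_sq_div_two] at h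
  linarith
end

section
/- Fix s > 0 and t > 0. Then lim_{i → −∞} ψ_t(2^i) = 0. -/
open Real Filter

/-- A stretched exponential with rate `2 * t` and exponent `s` is dominated by an inverse square. -/
theorem exp_neg_rpow_le_inv_sq {s t y : ℝ} (hs : 0 < s) (ht : 0 < t) (hy : 0 < y) :
    Real.exp (-2 * t * y ^ s) ≤ ((t * s) ^ (2 / s))⁻¹ * (y ^ 2)⁻¹ := by
  have hts : 0 < t * s := mul_pos ht hs
  have hys : 0 < y ^ s := Real.rpow_pos_of_pos hy s
  have h1 : t * s * y ^ s ≤ Real.exp (t * s * y ^ s) := by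
    linarith [Real.add_one_le_exp (t * s * y ^ s)]
  have h2 := Real.rpow_le_rpow (by positivity) h1 (show 0 ≤ 2 / s by positivity)
  rw [Real.mul_rpow hts.le hys.le, ← Real.rpow_mul hy.le, ← Real.exp_mul,
    mul_div_cancel₀ _ hs.ne', Real.rpow_two,
    show t * s * y ^ s * (2 / s) = 2 * t * y ^ s by field_simp] at h2
  rw [show -2 * t * y ^ s = -(2 * t * y ^ s) by ring, Real.exp_neg, ← mul_inv]
  exact inv_anti₀ (by positivity) h2

theorem etaFn_rpow_le {s t y : ℝ} (hs : 0 < s) (ht : 0 < t) (hy : 0 < y) :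
    etaFn s t (y ^ s) ≤ 3 * ((t * s) ^ (2 / s))⁻¹ * (y ^ 2)⁻¹ := by
  set C := ((t * s) ^ (2 / s))⁻¹
  have hterm : ∀ l : ℕ,
      (2 : ℝ) ^ (l + 1) * Real.exp (-2 * t * (2 : ℝ) ^ (s * ((l : ℝ) + 1)) * y ^ s) ≤
        C * (y ^ 2)⁻¹ / 2 * (1 / 2) ^ l := by
    intro l
    have hpow : (2 : ℝ) ^ (s * ((l : ℝ) + 1)) * y ^ s = ((2 : ℝ) ^ (l + 1) * y) ^ s := by
      rw [Real.mul_rpow (by positivity) hy.le, mul_comm s, Real.rpow_mul (by norm_num)]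
      norm_cast
    rw [mul_assoc (-2 * t), hpow]
    refine (mul_le_mul_of_nonneg_left
      (exp_neg_rpow_le_inv_sq hs ht (show 0 < (2 : ℝ) ^ (l + 1) * y by positivity))
      (by positivity)).trans_eq ?_
    rw [one_div, inv_pow]
    change (2 : ℝ) ^ (l + 1) * (C * _) = _
    field_simp
    ring
  have hgeom : HasSum (fun l : ℕ => C * (y ^ 2)⁻¹ / 2 * (1 / 2 : ℝ) ^ l) (C * (y ^ 2)⁻¹) := by
    simpa using hasSum_geometric_two.mul_left (C * (y ^ 2)⁻¹ / 2)
  have hsum := (Summable.of_nonneg_of_le (fun l => by positivity) hterm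
    hgeom.summable).tsum_le_tsum hterm hgeom.summable
  rw [hgeom.tsum_eq] at hsum
  have hfirst : Real.exp (-2 * t * y ^ s) ≤ C * (y ^ 2)⁻¹ := exp_neg_rpow_le_inv_sq hs ht hy
  unfold etaFn
  linarith

theorem psiFn_le_sqrt {s t lam : ℝ} (hs : 0 < s) (ht : 0 < t) (hlam : 0 < lam) :
    psiFn s t lam ≤ Real.sqrt (6 * ((t * s) ^ (2 / s))⁻¹ * lam) := by
  refine Real.sqrt_le_sqrt ?_
  rw [Real.rpow_neg hlam.le, ← Real.inv_rpow hlam.le]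
  refine (mul_le_mul_of_nonneg_left (etaFn_rpow_le hs ht (inv_pos.mpr hlam))
    (by positivity)).trans_eq ?_
  field_simp
  ring

/-- For `s > 0` and `t > 0`, `lim_{i → -∞} ψ_t(2^i) = 0`. -/
theorem psi_tendsto_zero_atBot (s t : ℝ) (hs : 0 < s) (ht : 0 < t) :
    Tendsto (fun i : ℤ => psiFn s t ((2 : ℝ) ^ i)) atBot (nhds 0) := by
  have hpow : Tendsto (fun i : ℤ => (2 : ℝ) ^ i) atBot (nhds 0) := by
    simpa [Function.comp_def] using
      (tendsto_rpow_atBot_of_base_gt_one (2 : ℝ) (by norm_num)).comp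
        ((tendsto_intCast_atBot_iff (R := ℝ)).mpr tendsto_id)
  refine squeeze_zero (fun i => Real.sqrt_nonneg _)
    (fun i => psiFn_le_sqrt hs ht (by positivity)) ?_
  simpa using (hpow.const_mul (6 * ((t * s) ^ (2 / s))⁻¹)).sqrt
end

section
/- Fix s > 0 and t > 0. Then the bilateral series Σ_{k ∈ ℤ} 2^{k} e^{−2t·2^{ks}} converges to a finite positive value and lim_{i → +∞} ψ_t(2^i) = √(2 Σ_{k ∈ ℤ} 2^{k} e^{−2t·2^{ks}}) < +∞. -/
open Real Filter

/-- The general term `2^k e^{-2t 2^{ks}}` of the bilateral series. -/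
noncomputable def bilateralTerm (s t : ℝ) (k : ℤ) : ℝ :=
  (2 : ℝ) ^ k * Real.exp (-2 * t * (2 : ℝ) ^ ((k : ℝ) * s))

lemma bilateralTerm_pos (s t : ℝ) (k : ℤ) : 0 < bilateralTerm s t k := by
  unfold bilateralTerm
  positivity

lemma bilateralTerm_le_zpow (s : ℝ) {t : ℝ} (ht : 0 < t) (k : ℤ) :
    bilateralTerm s t k ≤ (2 : ℝ) ^ k := by
  refine mul_le_of_le_one_right (by positivity) (Real.exp_le_one_iff.2 ?_)
  have : 0 < t * (2 : ℝ) ^ ((k : ℝ) * s) := by positivity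
  linarith

lemma exists_bilateralTerm_natCast_le {s t : ℝ} (hs : 0 < s) (ht : 0 < t) :
    ∃ C : ℝ, ∀ n : ℕ, bilateralTerm s t (n : ℤ) ≤ C * (1 / 2) ^ n := by
  obtain ⟨m, hm⟩ := exists_nat_ge (2 / s)
  have hm' : 2 ≤ m * s := (div_le_iff₀ hs).1 hm
  refine ⟨m.factorial / (2 * t) ^ m, fun n => ?_⟩
  set x : ℝ := (2 : ℝ) ^ ((n : ℝ) * s) with hx
  have hx0 : 0 < x := by positivity
  have hxm : (4 : ℝ) ^ n ≤ x ^ m := by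
    have h4 : (4 : ℝ) ^ n = (2 : ℝ) ^ ((n : ℝ) * 2) := by
      rw [mul_comm, Real.rpow_mul (by norm_num), Real.rpow_natCast]
      norm_num
    rw [h4, hx, ← Real.rpow_mul_natCast (by norm_num)]
    refine Real.rpow_le_rpow_of_exponent_le (by norm_num) ?_
    nlinarith [(Nat.cast_nonneg n : (0 : ℝ) ≤ n)]
  have hexp : Real.exp (-2 * t * x) ≤ m.factorial / ((2 * t) ^ m * 4 ^ n) := by
    have h := Real.pow_div_factorial_le_exp (2 * t * x) (by positivity) m
    have hle : (2 * t) ^ m * 4 ^ n / m.factorial ≤ Real.exp (2 * t * x) := by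
      refine le_trans ?_ h
      rw [mul_pow (2 * t) x]
      gcongr
    rw [show -2 * t * x = -(2 * t * x) by ring, Real.exp_neg, ← inv_div]
    exact inv_anti₀ (by positivity) hle
  have hterm : bilateralTerm s t (n : ℤ) = 2 ^ n * Real.exp (-2 * t * x) := by
    simp [bilateralTerm, hx]
  calc bilateralTerm s t (n : ℤ)
      ≤ 2 ^ n * (m.factorial / ((2 * t) ^ m * 4 ^ n)) := by
        rw [hterm]
        gcongr
    _ = m.factorial / (2 * t) ^ m * (1 / 2) ^ n := by
        rw [show (4 : ℝ) = 2 * 2 by norm_num, mul_pow (2 : ℝ) 2 n, one_div, inv_pow]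
        field_simp

lemma summable_bilateralTerm {s t : ℝ} (hs : 0 < s) (ht : 0 < t) :
    Summable (bilateralTerm s t) := by
  have hgeom : Summable fun n : ℕ => (1 / 2 : ℝ) ^ n := summable_geometric_two
  obtain ⟨C, hC⟩ := exists_bilateralTerm_natCast_le hs ht
  refine Summable.of_nat_of_neg ?_ ?_
  · exact (hgeom.mul_left C).of_nonneg_of_le (fun n => (bilateralTerm_pos s t _).le) hC
  · refine hgeom.of_nonneg_of_le (fun n => (bilateralTerm_pos s t _).le) fun n => ?_
    simpa using bilateralTerm_le_zpow s ht (-(n : ℤ))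

lemma tendsto_bilateralTerm_neg {s t : ℝ} (hs : 0 < s) (ht : 0 < t) :
    Tendsto (fun i : ℤ => bilateralTerm s t (-i)) atTop (nhds 0) :=
  ((summable_bilateralTerm hs ht).tendsto_cofinite_zero.comp
    neg_injective.tendsto_cofinite).mono_left atTop_le_cofinite

/-- The sums of a summable bilateral sequence over the half-lines `k ≥ 1 - i` converge to the
full sum as `i → ∞`. -/
lemma Summable.tendsto_tsum_shift {f : ℤ → ℝ} (hf : Summable f) :
    Tendsto (fun i : ℤ => ∑' l : ℕ, f ((l : ℤ) + 1 - i)) atTop (nhds (∑' k, f k)) := by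
  have heq : ∀ i : ℤ, ∑' l : ℕ, f ((l : ℤ) + 1 - i) =
      ∑' k, (Set.Ici (1 - i)).indicator f k := by
    intro i
    have hinj : Function.Injective fun l : ℕ => (l : ℤ) + 1 - i := fun a b h => by
      simp only at h
      omega
    rw [← hinj.tsum_eq]
    · refine tsum_congr fun l => (Set.indicator_of_mem ?_ f).symm
      simp only [Set.mem_Ici]
      omega
    · refine Function.support_subset_iff'.2 fun k hk => Set.indicator_of_notMem ?_ f
      intro hmem
      rw [Set.mem_Ici] at hmem
      exact hk ⟨(k - 1 + i).toNat, by simp only; omega⟩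
  simp only [heq]
  refine tendsto_tsum_of_dominated_convergence hf.norm (fun k => ?_) ?_
  · refine tendsto_const_nhds.congr' ?_
    filter_upwards [eventually_ge_atTop (1 - k)] with i hi
    rw [Set.indicator_of_mem]
    simp only [Set.mem_Ici]
    omega
  · exact Eventually.of_forall fun i k => norm_indicator_le_norm_self f k

lemma psiFn_two_zpow (s t : ℝ) (i : ℤ) :
    psiFn s t ((2 : ℝ) ^ i) = Real.sqrt (2 * (2 * bilateralTerm s t (-i) +
      ∑' l : ℕ, bilateralTerm s t ((l : ℤ) + 1 - i))) := by
  have hpow : ((2 : ℝ) ^ i) ^ (-s) = (2 : ℝ) ^ (-(i : ℝ) * s) := by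
    rw [← Real.rpow_intCast, ← Real.rpow_mul (by norm_num)]
    ring_nf
  have hterm : ∀ l : ℕ, bilateralTerm s t ((l : ℤ) + 1 - i) = ((2 : ℝ) ^ i)⁻¹ *
      ((2 : ℝ) ^ (l + 1) * Real.exp (-2 * t * (2 : ℝ) ^ (s * ((l : ℝ) + 1)) *
        (2 : ℝ) ^ (-(i : ℝ) * s))) := by
    intro l
    rw [mul_assoc (-2 * t), ← Real.rpow_add (by norm_num), bilateralTerm,
      zpow_sub₀ (by norm_num), div_eq_inv_mul, mul_assoc]
    congr 2
    push_cast
    ring_nf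
  simp only [psiFn, etaFn, hpow, hterm, tsum_mul_left]
  simp only [bilateralTerm, zpow_neg, Int.cast_neg]
  congr 1
  ring

/-- The bilateral series `Σ_{k ∈ ℤ} 2^k e^{-2t 2^{ks}}` converges to a finite positive value
and `lim_{i → +∞} ψ_t(2^i) = √(2 Σ_{k ∈ ℤ} 2^k e^{-2t 2^{ks}}) < ∞`. -/
theorem psi_tendsto_finite_atTop (s t : ℝ) (hs : 0 < s) (ht : 0 < t) :
    Summable (fun k : ℤ => (2 : ℝ) ^ k * Real.exp (-2 * t * (2 : ℝ) ^ ((k : ℝ) * s))) ∧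
    0 < (∑' k : ℤ, (2 : ℝ) ^ k * Real.exp (-2 * t * (2 : ℝ) ^ ((k : ℝ) * s))) ∧
    Tendsto (fun i : ℤ => psiFn s t ((2 : ℝ) ^ i)) atTop
      (nhds (Real.sqrt (2 * ∑' k : ℤ, (2 : ℝ) ^ k *
        Real.exp (-2 * t * (2 : ℝ) ^ ((k : ℝ) * s))))) := by
  have hsum := summable_bilateralTerm hs ht
  refine ⟨hsum, hsum.tsum_pos (fun k => (bilateralTerm_pos s t k).le) 0
    (bilateralTerm_pos s t 0), ?_⟩
  simp only [psiFn_two_zpow]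
  have hlim := (((tendsto_bilateralTerm_neg hs ht).const_mul 2).add
    hsum.tendsto_tsum_shift).const_mul 2
  rw [mul_zero, zero_add] at hlim
  exact hlim.sqrt
end
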